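/- arXiv:2204.14254 — 7 statements merged into one kernel-verified Lean document; each statement's English description precedes it below -/
import Mathlib

section
/- Let n ≥ 3 and let C ⊊ ℝⁿ be a closed convex set (possibly empty) which is neither a closed halfspace {x : ℓ(x) ≤ c} nor a slab {x : a ≤ ℓ(x) ≤ b} for some nonzero linear functional ℓ on ℝⁿ and real numbers c, respectively a ≤ b. Then the open set Ω = ℝⁿ ∖ C satisfies condition (FLEX): for every p ∈ Ω there is a 2-dimensional affine subspace Λ ⊆ ℝⁿ with p ∈ Λ such that (a) there is δ > 0 with {x : dist(x, Λ) < δ} ∩ C = ∅, and (b) for every r > 0 there is q ∈ Λ with B̄(q, r) ∩ C = ∅. (This is the geometric content of the corollary that complements of such convex sets are flexible.) -/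
open Metric Set

noncomputable section

/-- A nonzero vector of a subspace of dimension at least two lies in a plane of that subspace. -/
theorem Submodule.exists_plane_of_mem {E : Type*} [AddCommGroup E] [Module ℝ E]
    (W : Submodule ℝ E) (hW : 1 < Module.finrank ℝ W) {v : E} (hv : v ∈ W) (hv0 : v ≠ 0) :
    ∃ V : Submodule ℝ E, V ≤ W ∧ v ∈ V ∧ Module.finrank ℝ V = 2 := by
  have hx : (⟨v, hv⟩ : W) ≠ 0 := fun h => hv0 (congrArg Subtype.val h)
  obtain ⟨w, hw⟩ := exists_linearIndependent_pair_of_one_lt_finrank hW hx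
  have hli := hw.map' W.subtype W.ker_subtype
  refine ⟨Submodule.span ℝ (Set.range (W.subtype ∘ ![⟨v, hv⟩, w])), ?_, ?_, ?_⟩
  · rw [Submodule.span_le]
    rintro _ ⟨i, rfl⟩
    exact (![(⟨v, hv⟩ : W), w] i).2
  · exact Submodule.subset_span ⟨0, rfl⟩
  · simpa using finrank_span_eq_card hli

/-- If every point of a ray stays at bounded distance from a closed convex set, then the direction
of the ray is a direction of recession of the set. -/
theorem Convex.add_mem_of_forall_closedBall_inter_nonempty {E : Type*} [NormedAddCommGroup E]
    [NormedSpace ℝ E] {C : Set E} (hC : Convex ℝ C) (hclosed : IsClosed C) {p v : E} {r : ℝ}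
    (h : ∀ t : ℝ, (closedBall (p + t • v) r ∩ C).Nonempty) {c : E} (hc : c ∈ C) :
    c + v ∈ C := by
  choose y hy hyC using h
  have hlim : Filter.Tendsto (fun k : ℕ => c + ((k : ℝ) + 1)⁻¹ • (y ((k : ℝ) + 1) - c))
      Filter.atTop (nhds (c + v)) := by
    rw [tendsto_iff_norm_sub_tendsto_zero]
    have hbound : Filter.Tendsto (fun k : ℕ => (1 / ((k : ℝ) + 1)) * (r + ‖p - c‖))
        Filter.atTop (nhds 0) := by
      simpa using tendsto_one_div_add_atTop_nhds_zero_nat.mul_const (r + ‖p - c‖)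
    refine squeeze_zero (fun _ => norm_nonneg _) (fun k => ?_) hbound
    have hk : (0 : ℝ) < (k : ℝ) + 1 := by positivity
    have heq : c + ((k : ℝ) + 1)⁻¹ • (y ((k : ℝ) + 1) - c) - (c + v) =
        ((k : ℝ) + 1)⁻¹ • ((y ((k : ℝ) + 1) - (p + ((k : ℝ) + 1) • v)) + (p - c)) := by
      have : v = ((k : ℝ) + 1)⁻¹ • (((k : ℝ) + 1) • v) := by
        rw [smul_smul, inv_mul_cancel₀ hk.ne', one_smul]
      nth_rewrite 1 [this]
      module
    rw [heq, norm_smul, Real.norm_of_nonneg (by positivity), one_div]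
    gcongr
    exact (norm_add_le _ _).trans (by gcongr; exact mem_closedBall_iff_norm.1 (hy _))
  refine hclosed.mem_of_tendsto hlim (Filter.Eventually.of_forall fun k => ?_)
  have hk : (0 : ℝ) < (k : ℝ) + 1 := by positivity
  exact hC.add_smul_sub_mem hc (hyC _)
    ⟨by positivity, inv_le_one_of_one_le₀ (by linarith [Nat.cast_nonneg (α := ℝ) k])⟩

/-- A nonempty closed convex set which is invariant under translation by the kernel of a nonzero
functional bounded above on it is a halfspace or a slab. -/
theorem Convex.halfspace_or_slab_of_add_ker_mem {E : Type*} [NormedAddCommGroup E]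
    [NormedSpace ℝ E] {C : Set E} (hC : Convex ℝ C) (hclosed : IsClosed C) (hne : C.Nonempty)
    (f : E →ₗ[ℝ] ℝ) (hf : f ≠ 0) (hbdd : BddAbove (f '' C))
    (hinv : ∀ c ∈ C, ∀ v, f v = 0 → c + v ∈ C) :
    (∃ c : ℝ, C = {x | f x ≤ c}) ∨ ∃ a b : ℝ, a ≤ b ∧ C = {x | a ≤ f x ∧ f x ≤ b} := by
  obtain ⟨e, he⟩ : ∃ e, f e = 1 := f.surjective hf 1
  have hmem : ∀ x, x ∈ C ↔ f x ∈ f '' C := by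
    refine fun x => ⟨fun hx => ⟨x, hx, rfl⟩, ?_⟩
    rintro ⟨c, hc, hcx⟩
    simpa using hinv c hc (x - c) (by simp [hcx])
  have himage : f '' C = (fun t : ℝ => t • e) ⁻¹' C := by
    ext t
    rw [Set.mem_preimage, hmem]
    simp [he]
  have hIclosed : IsClosed (f '' C) := by
    rw [himage]
    exact hclosed.preimage (by fun_prop)
  have hIne : (f '' C).Nonempty := hne.image f
  have hord : (f '' C).OrdConnected := (hC.linear_image f).ordConnected
  have hsup := hIclosed.csSup_mem hIne hbdd
  by_cases hbelow : BddBelow (f '' C)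
  · have hinf := hIclosed.csInf_mem hIne hbelow
    refine Or.inr ⟨sInf (f '' C), sSup (f '' C), csInf_le hbelow hsup, ?_⟩
    ext x
    rw [hmem]
    exact ⟨fun h => ⟨csInf_le hbelow h, le_csSup hbdd h⟩, fun h => hord.out hinf hsup h⟩
  · refine Or.inl ⟨sSup (f '' C), ?_⟩
    ext x
    rw [hmem]
    refine ⟨fun h => le_csSup hbdd h, fun h => ?_⟩
    obtain ⟨y, hy, hyx⟩ := not_bddBelow_iff.1 hbelow (f x)
    exact hord.out hy hsup ⟨hyx.le, h⟩

/-- The complement of a proper closed convex set `C ⊆ ℝⁿ` (`n ≥ 3`) which is neither a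
closed halfspace nor a slab satisfies condition (FLEX): through every point of the
complement there is a 2-dimensional affine subspace `Λ` such that a `δ`-tube around `Λ`
misses `C`, and `Λ` contains centres of arbitrarily large closed balls missing `C`. -/
theorem complement_convex_satisfies_flex {n : ℕ} (hn : 3 ≤ n)
    (C : Set (EuclideanSpace ℝ (Fin n))) (hCclosed : IsClosed C) (hCconv : Convex ℝ C)
    (hCproper : C ≠ Set.univ)
    (hnothalf : ¬∃ (ℓ : EuclideanSpace ℝ (Fin n) →ₗ[ℝ] ℝ) (c : ℝ),
      ℓ ≠ 0 ∧ C = {x | ℓ x ≤ c})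
    (hnotslab : ¬∃ (ℓ : EuclideanSpace ℝ (Fin n) →ₗ[ℝ] ℝ) (a b : ℝ),
      ℓ ≠ 0 ∧ a ≤ b ∧ C = {x | a ≤ ℓ x ∧ ℓ x ≤ b}) :
    ∀ p ∈ Cᶜ, ∃ Λ : AffineSubspace ℝ (EuclideanSpace ℝ (Fin n)),
      Module.finrank ℝ Λ.direction = 2 ∧ p ∈ Λ ∧
      (∃ δ > 0, {x | Metric.infDist x (Λ : Set (EuclideanSpace ℝ (Fin n))) < δ} ∩ C = ∅) ∧
      (∀ r > 0, ∃ q ∈ Λ, Metric.closedBall q r ∩ C = ∅) := by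
  intro p hp
  have hdim : Module.finrank ℝ (EuclideanSpace ℝ (Fin n)) = n := by simp
  rcases C.eq_empty_or_nonempty with rfl | hne
  · have : Nontrivial (EuclideanSpace ℝ (Fin n)) :=
      Module.nontrivial_of_finrank_pos (R := ℝ) (by omega)
    obtain ⟨v, hv⟩ := exists_ne (0 : EuclideanSpace ℝ (Fin n))
    obtain ⟨V, -, -, hV⟩ := Submodule.exists_plane_of_mem ⊤
      (by rw [finrank_top]; omega) (Submodule.mem_top (x := v)) hv
    exact ⟨AffineSubspace.mk' p V, by rwa [AffineSubspace.direction_mk'], AffineSubspace.self_mem_mk' p V,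
      ⟨1, one_pos, by simp⟩, fun r _ => ⟨p, AffineSubspace.self_mem_mk' p V, by simp⟩⟩
  obtain ⟨f, u, hfC, hfp⟩ := geometric_hahn_banach_closed_point hCconv hCclosed hp
  have hf : (f : EuclideanSpace ℝ (Fin n) →ₗ[ℝ] ℝ) ≠ 0 := by
    intro h
    have h0 : ∀ x, f x = 0 := fun x => LinearMap.congr_fun h x
    obtain ⟨c, hc⟩ := hne
    have := hfC c hc
    rw [h0] at this hfp
    linarith
  obtain ⟨v, hfv, hv⟩ : ∃ v, f v = 0 ∧ ∀ r : ℝ, ∃ t : ℝ, closedBall (p + t • v) r ∩ C = ∅ := by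
    by_contra! hcon
    have hinv : ∀ c ∈ C, ∀ v, f v = 0 → c + v ∈ C := by
      intro c hc v hv
      obtain ⟨r, hr⟩ := hcon v hv
      exact hCconv.add_mem_of_forall_closedBall_inter_nonempty hCclosed hr hc
    have hbdd : BddAbove ((f : EuclideanSpace ℝ (Fin n) →ₗ[ℝ] ℝ) '' C) := by
      refine ⟨u, ?_⟩
      rintro _ ⟨c, hc, rfl⟩
      exact (hfC c hc).le
    rcases hCconv.halfspace_or_slab_of_add_ker_mem hCclosed hne _ hf hbdd hinv with
      ⟨c, hc⟩ | ⟨a, b, hab, h⟩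
    · exact hnothalf ⟨_, c, hf, hc⟩
    · exact hnotslab ⟨_, a, b, hf, hab, h⟩
  have hv0 : v ≠ 0 := by
    rintro rfl
    obtain ⟨c, hc⟩ := hne
    obtain ⟨t, ht⟩ := hv (dist c p)
    exact (Set.ext_iff.1 ht c).1 ⟨by simp, hc⟩
  have hker := Module.Dual.finrank_ker_add_one_of_ne_zero hf
  obtain ⟨V, hVker, hvV, hV⟩ := Submodule.exists_plane_of_mem
    (LinearMap.ker (f : EuclideanSpace ℝ (Fin n) →ₗ[ℝ] ℝ)) (by omega) (v := v) hfv hv0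
  refine ⟨AffineSubspace.mk' p V, by rwa [AffineSubspace.direction_mk'], AffineSubspace.self_mem_mk' p V,
    ⟨(f p - u) / (‖f‖ + 1), div_pos (by linarith) (by positivity), ?_⟩, fun r _ => ?_⟩
  · refine Set.eq_empty_of_forall_notMem ?_
    rintro x ⟨hx, hxC⟩
    obtain ⟨y, hy, hxy⟩ := (infDist_lt_iff ⟨p, AffineSubspace.self_mem_mk' p V⟩).1 hx
    have hfy : f (y - p) = 0 := hVker ((AffineSubspace.mem_mk').1 hy)
    have hle : f (y - x) ≤ ‖f‖ * dist x y := by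
      rw [dist_comm, dist_eq_norm]
      exact (le_abs_self _).trans (f.le_opNorm _)
    rw [lt_div_iff₀ (by positivity)] at hxy
    rw [map_sub] at hfy hle
    nlinarith [hfC x hxC, dist_nonneg (x := x) (y := y)]
  · obtain ⟨t, ht⟩ := hv r
    exact ⟨p + t • v, AffineSubspace.mem_mk'.2 (by simpa using V.smul_mem t hvV), ht⟩
end
end

section
/- Let C ⊆ ℝⁿ be a nonempty closed convex set and let k ∈ ℕ be such that C contains a k-dimensional affine subspace of ℝⁿ but contains no (k+1)-dimensional affine subspace. Then there exists a k-dimensional linear subspace V ⊆ ℝⁿ such that C + v = C for every v ∈ V, C = (C ∩ V^⊥) + V (where V^⊥ is the orthogonal complement of V), and the closed convex set C ∩ V^⊥ contains no affine line (no 1-dimensional affine subspace). -/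
open Metric Set

noncomputable section

/-- A closed convex set containing a ray is stable under translation by the ray's direction. -/
theorem Convex.add_mem_of_ray_subset {E : Type*} [NormedAddCommGroup E] [NormedSpace ℝ E]
    {C : Set E} (hconv : Convex ℝ C) (hclosed : IsClosed C) {a v x : E}
    (hray : ∀ t : ℝ, 0 ≤ t → a + t • v ∈ C) (hx : x ∈ C) : x + v ∈ C := by
  have hlim : Filter.Tendsto (fun m : ℕ => x + v + (1 / ((m : ℝ) + 1)) • (a - x))
      Filter.atTop (nhds (x + v)) := by
    simpa using
      ((tendsto_one_div_add_atTop_nhds_zero_nat (𝕜 := ℝ)).smul_const (a - x)).const_add (x + v)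
  refine hclosed.mem_of_tendsto hlim (Filter.Eventually.of_forall fun m => ?_)
  have hm : (0 : ℝ) < m + 1 := by positivity
  have hle : 1 / ((m : ℝ) + 1) ≤ 1 := by
    rw [div_le_one hm]
    linarith [m.cast_nonneg (α := ℝ)]
  have hcomb := hconv hx (hray (m + 1) hm.le) (sub_nonneg.2 hle) (by positivity)
    (sub_add_cancel 1 (1 / ((m : ℝ) + 1)))
  convert hcomb using 1
  rw [smul_add, smul_smul, one_div_mul_cancel hm.ne']
  module

/-- A closed convex set containing a translate of a subspace is stable under translation by the
elements of that subspace. -/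
theorem Convex.add_mem_of_translate_subset {E : Type*} [NormedAddCommGroup E] [NormedSpace ℝ E]
    {C : Set E} (hconv : Convex ℝ C) (hclosed : IsClosed C) {a : E} {W : Submodule ℝ E}
    (hW : (fun w => a + w) '' (W : Set E) ⊆ C) {x v : E} (hx : x ∈ C) (hv : v ∈ W) :
    x + v ∈ C :=
  hconv.add_mem_of_ray_subset hclosed
    (fun t _ => hW (mem_image_of_mem _ (W.smul_mem t hv))) hx

/-- Adjoining a vector outside a finite-dimensional subspace raises the dimension by one. -/
theorem Submodule.finrank_sup_span_singleton_of_notMem {K E : Type*} [DivisionRing K]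
    [AddCommGroup E] [Module K E] (W : Submodule K E) [FiniteDimensional K W] {v : E}
    (hv : v ∉ W) :
    Module.finrank K ↥(W ⊔ Submodule.span K {v}) = Module.finrank K W + 1 := by
  have hv0 : v ≠ 0 := fun h => hv (h ▸ W.zero_mem)
  have hinf : W ⊓ Submodule.span K {v} = ⊥ :=
    disjoint_iff.1 ((Submodule.disjoint_span_singleton' hv0).2 hv)
  have hdim := Submodule.finrank_sup_add_finrank_inf_eq W (Submodule.span K {v})
  rwa [hinf, finrank_bot, add_zero, finrank_span_singleton hv0] at hdim

/-- Splitting off the lineality directions of a closed convex set: if `C ⊆ ℝⁿ` is nonempty,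
closed, convex, contains a `k`-dimensional affine subspace but no `(k+1)`-dimensional one,
then there is a `k`-dimensional linear subspace `V` of translation invariance with
`C = (C ∩ V^⊥) + V`, and `C ∩ V^⊥` contains no affine line. -/
theorem convex_splits_off_lineality {n : ℕ}
    (C : Set (EuclideanSpace ℝ (Fin n))) (hne : C.Nonempty)
    (hCclosed : IsClosed C) (hCconv : Convex ℝ C) (k : ℕ)
    (hcontains : ∃ (a : EuclideanSpace ℝ (Fin n)) (W : Submodule ℝ (EuclideanSpace ℝ (Fin n))),
      Module.finrank ℝ W = k ∧ (fun w => a + w) '' (W : Set (EuclideanSpace ℝ (Fin n))) ⊆ C)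
    (hnotcontains : ¬∃ (a : EuclideanSpace ℝ (Fin n))
        (W : Submodule ℝ (EuclideanSpace ℝ (Fin n))),
      Module.finrank ℝ W = k + 1 ∧ (fun w => a + w) '' (W : Set (EuclideanSpace ℝ (Fin n))) ⊆ C) :
    ∃ V : Submodule ℝ (EuclideanSpace ℝ (Fin n)),
      Module.finrank ℝ V = k ∧
      (∀ v ∈ V, (fun x => x + v) '' C = C) ∧
      (C = {x | ∃ y ∈ C ∩ (Vᗮ : Set (EuclideanSpace ℝ (Fin n))),
        ∃ v ∈ (V : Set (EuclideanSpace ℝ (Fin n))), x = y + v}) ∧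
      (¬∃ (a v : EuclideanSpace ℝ (Fin n)), v ≠ 0 ∧
        ∀ t : ℝ, a + t • v ∈ C ∩ (Vᗮ : Set (EuclideanSpace ℝ (Fin n)))) := by
  obtain ⟨a, W, hdim, hW⟩ := hcontains
  have hadd : ∀ x ∈ C, ∀ v ∈ W, x + v ∈ C := fun x hx v hv =>
    hCconv.add_mem_of_translate_subset hCclosed hW hx hv
  refine ⟨W, hdim, fun v hv => ?_, ?_, ?_⟩
  · refine Subset.antisymm (image_subset_iff.2 fun x hx => hadd x hx v hv) fun x hx => ?_
    exact ⟨x + -v, hadd x hx _ (W.neg_mem hv), by simp⟩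
  · ext x
    constructor
    · intro hx
      have hp : W.starProjection x ∈ W := W.starProjection_apply_mem x
      refine ⟨x - W.starProjection x, ⟨?_, W.sub_starProjection_mem_orthogonal x⟩,
        W.starProjection x, hp, by simp⟩
      rw [sub_eq_add_neg]
      exact hadd x hx _ (W.neg_mem hp)
    · rintro ⟨y, hy, v, hv, rfl⟩
      exact hadd y hy.1 v hv
  · rintro ⟨b, v, hv0, hline⟩
    have hvperp : v ∈ Wᗮ := by
      simpa using Wᗮ.sub_mem (hline 1).2 (hline 0).2
    have hvW : v ∉ W := fun h =>
      hv0 (Submodule.disjoint_def.1 W.orthogonal_disjoint v h hvperp)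
    refine hnotcontains ⟨b, W ⊔ Submodule.span ℝ {v}, ?_, ?_⟩
    · rw [W.finrank_sup_span_singleton_of_notMem hvW, hdim]
    · rintro _ ⟨u, hu, rfl⟩
      obtain ⟨w, hw, z, hz, rfl⟩ := Submodule.mem_sup.1 hu
      obtain ⟨c, rfl⟩ := Submodule.mem_span_singleton.1 hz
      have hmem := hadd _ (hline c).1 w hw
      rwa [add_assoc, add_comm (c • v)] at hmem
end
end

section
/- Let m ≥ 2 and let C ⊆ ℂᵐ be a closed convex set which contains no affine complex line. Then for every point p ∈ ℂᵐ ∖ C the family of affine complex hyperplanes H ⊆ ℂᵐ with p ∈ H and H ∩ C = ∅ is nonempty, and the intersection of all such hyperplanes equals {p}. In particular, there exist two distinct affine complex hyperplanes through p which are disjoint from C. -/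
open Metric Set

noncomputable section

/-- A closed convex set containing no affine complex line can be avoided by a complex hyperplane
through an exterior point `p` which is transverse to a prescribed direction `v`. -/
theorem exists_dual_apply_ne_zero_forall_ne {E : Type*} [NormedAddCommGroup E] [NormedSpace ℂ E]
    {C : Set E} (hCclosed : IsClosed C) (hCconv : Convex ℝ C)
    (hline : ¬∃ a v : E, v ≠ 0 ∧ ∀ t : ℂ, a + t • v ∈ C)
    {p : E} (hp : p ∉ C) {v : E} (hv : v ≠ 0) :
    ∃ f : StrongDual ℂ E, f v ≠ 0 ∧ ∀ x ∈ C, f x ≠ f p := by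
  rcases C.eq_empty_or_nonempty with rfl | ⟨c, hc⟩
  · obtain ⟨f, hf⟩ := SeparatingDual.exists_ne_zero (R := ℂ) hv
    exact ⟨f, hf, by simp⟩
  obtain ⟨f, u, hfp, hfC⟩ :=
    RCLike.geometric_hahn_banach_point_closed (𝕜 := ℂ) hCconv hCclosed hp
  by_cases hfv : f v = 0
  swap
  · refine ⟨f, hfv, fun x hx h ↦ ?_⟩
    have := hfC x hx
    rw [h] at this
    exact lt_asymm hfp this
  obtain ⟨t, ht⟩ : ∃ t : ℂ, c + t • v ∉ C := by
    by_contra! h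
    exact hline ⟨c, v, hv, h⟩
  obtain ⟨g, s, hgt, hgC⟩ :=
    RCLike.geometric_hahn_banach_point_closed (𝕜 := ℂ) hCconv hCclosed ht
  simp only [RCLike.re_to_complex] at hfp hfC hgt hgC
  have hgv : g v ≠ 0 := by
    intro h
    have := hgC c hc
    simp only [map_add, map_smul, h, smul_zero, add_zero] at hgt
    exact lt_asymm hgt this
  -- A small multiple of `g` keeps the strict separation given by `f`.
  obtain ⟨ε, hε, hεu⟩ : ∃ ε : ℝ, 0 < ε ∧ ((g p).re - s) * ε < u - (f p).re :=
    exists_pos_mul_lt (sub_pos.2 hfp) _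
  refine ⟨f + (ε : ℂ) • g, by simp [hfv, hgv, hε.ne'], fun x hx h ↦ ?_⟩
  have hre := congrArg Complex.re h
  simp only [add_apply, smul_apply, smul_eq_mul,
    Complex.add_re, Complex.re_ofReal_mul] at hre
  have := mul_lt_mul_of_pos_left (hgC x hx) hε
  linarith [hfC x hx]

/-- For a closed convex set `C ⊆ ℂᵐ` (`m ≥ 2`, convexity in the real sense) containing no
affine complex line, and a point `p ∉ C`: the family of affine complex hyperplanes through
`p` disjoint from `C` is nonempty, its intersection is `{p}`, and in particular it
contains two distinct members. -/
theorem complex_hyperplanes_through_exterior_point {m : ℕ} (hm : 2 ≤ m)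
    (C : Set (EuclideanSpace ℂ (Fin m))) (hCclosed : IsClosed C) (hCconv : Convex ℝ C)
    (hline : ¬∃ (a v : EuclideanSpace ℂ (Fin m)), v ≠ 0 ∧ ∀ t : ℂ, a + t • v ∈ C)
    (p : EuclideanSpace ℂ (Fin m)) (hp : p ∉ C) :
    (letI ℋ : Set (Set (EuclideanSpace ℂ (Fin m))) :=
      {H | (∃ (ℓ : EuclideanSpace ℂ (Fin m) →ₗ[ℂ] ℂ) (c : ℂ), ℓ ≠ 0 ∧ H = {z | ℓ z = c}) ∧
        p ∈ H ∧ H ∩ C = ∅}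
    ℋ.Nonempty ∧ ⋂₀ ℋ = {p} ∧ ∃ H₁ ∈ ℋ, ∃ H₂ ∈ ℋ, H₁ ≠ H₂) := by
  have key : ∀ v : EuclideanSpace ℂ (Fin m), v ≠ 0 →
      ∃ ℓ : EuclideanSpace ℂ (Fin m) →ₗ[ℂ] ℂ, ℓ v ≠ 0 ∧ ∀ x ∈ C, ℓ x ≠ ℓ p := fun v hv ↦
    let ⟨f, hfv, hf⟩ := exists_dual_apply_ne_zero_forall_ne hCclosed hCconv hline hp hv
    ⟨f, hfv, hf⟩
  have mem : ∀ (ℓ : EuclideanSpace ℂ (Fin m) →ₗ[ℂ] ℂ) (v : EuclideanSpace ℂ (Fin m)),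
      ℓ v ≠ 0 → (∀ x ∈ C, ℓ x ≠ ℓ p) →
      {z | ℓ z = ℓ p} ∈ {H : Set (EuclideanSpace ℂ (Fin m)) |
        (∃ (ℓ : EuclideanSpace ℂ (Fin m) →ₗ[ℂ] ℂ) (c : ℂ), ℓ ≠ 0 ∧ H = {z | ℓ z = c}) ∧
        p ∈ H ∧ H ∩ C = ∅} := fun ℓ v hv hC ↦
    ⟨⟨ℓ, ℓ p, fun h ↦ hv (by simp [h]), rfl⟩, rfl,
      Set.eq_empty_of_forall_notMem fun x hx ↦ hC x hx.2 hx.1⟩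
  obtain ⟨w, hw⟩ : ∃ w : EuclideanSpace ℂ (Fin m), w ≠ 0 :=
    ⟨EuclideanSpace.single ⟨0, by omega⟩ 1, by simp⟩
  obtain ⟨ℓ₁, h₁w, h₁C⟩ := key w hw
  obtain ⟨v, hv, h₁v⟩ : ∃ v, v ≠ 0 ∧ ℓ₁ v = 0 := by
    have hker : LinearMap.ker ℓ₁ ≠ ⊥ := LinearMap.ker_ne_bot_of_finrank_lt (by simp; omega)
    obtain ⟨v, hv, hv0⟩ := (Submodule.ne_bot_iff _).1 hker
    exact ⟨v, hv0, hv⟩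
  obtain ⟨ℓ₂, h₂v, h₂C⟩ := key v hv
  refine ⟨⟨_, mem ℓ₁ w h₁w h₁C⟩, ?_, _, mem ℓ₁ w h₁w h₁C, _, mem ℓ₂ v h₂v h₂C, fun h ↦ ?_⟩
  · refine Set.Subset.antisymm (fun z hz ↦ ?_) (Set.singleton_subset_iff.2 fun H hH ↦ hH.2.1)
    by_contra hzp
    obtain ⟨ℓ, hℓ, hℓC⟩ := key (z - p) (sub_ne_zero.2 hzp)
    refine hℓ ?_
    rw [map_sub, sub_eq_zero]
    exact hz _ (mem ℓ _ hℓ hℓC)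
  · have hmem : p + v ∈ {z | ℓ₁ z = ℓ₁ p} := by simp [h₁v]
    rw [h] at hmem
    exact h₂v (by simpa using hmem)
end
end

section
/- Let m ≥ 2 and let C ⊆ ℂᵐ be a closed convex set which contains no affine complex line. Then for every p ∈ ℂᵐ ∖ C there exist an invertible ℂ-affine map Φ : ℂ^{m−1} × ℂ → ℂᵐ with Φ(0, 0) = p and a number δ > 0 such that Φ({(z', zₘ) : ‖z'‖ < δ}) ∩ C = ∅, and for every r > 0 there is v ∈ ℂ with Φ({(z', v) : ‖z'‖ < r}) ∩ C = ∅. (The complement of a line-free closed convex set in ℂᵐ satisfies, in suitable complex affine coordinates at every point, the tube condition around a complex line and the arbitrarily-large-hyperplane-ball condition.) -/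
open Metric Set

noncomputable section

/-- A nonzero vector of `ℂᵐ` spans the last axis of some linear coordinate system
`ℂᵐ⁻¹ × ℂ ≃ ℂᵐ`. -/
theorem exists_linearEquiv_prod_apply_zero_one {m : ℕ} {w : EuclideanSpace ℂ (Fin m)}
    (hw : w ≠ 0) :
    ∃ A : (EuclideanSpace ℂ (Fin (m - 1)) × ℂ) ≃ₗ[ℂ] EuclideanSpace ℂ (Fin m),
      A (0, 1) = w := by
  obtain ⟨H, hH⟩ := Submodule.exists_isCompl (ℂ ∙ w)
  have hdim := Submodule.finrank_add_eq_of_isCompl hH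
  rw [finrank_span_singleton hw, finrank_euclideanSpace_fin] at hdim
  let e : EuclideanSpace ℂ (Fin (m - 1)) ≃ₗ[ℂ] H :=
    LinearEquiv.ofFinrankEq _ _ (by rw [finrank_euclideanSpace_fin]; omega)
  refine ⟨(e.prodCongr (LinearEquiv.toSpanNonzeroSingleton ℂ _ w hw)).trans
    (Submodule.prodEquivOfIsCompl H (ℂ ∙ w) hH.symm), ?_⟩
  simp

/-- If every complex functional whose real part is bounded above on a closed convex set `C`
vanishes on `w`, then `C` is invariant under translation by complex multiples of `w`. -/
theorem add_smul_mem_of_forall_bounded_functional_eq_zero {E : Type*} [NormedAddCommGroup E]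
    [NormedSpace ℂ E] {C : Set E} (hCclosed : IsClosed C) (hCconv : Convex ℝ C) {a w : E}
    (ha : a ∈ C)
    (hw : ∀ (l : E →L[ℂ] ℂ) (M : ℝ), (∀ c ∈ C, (l c).re ≤ M) → l w = 0) (t : ℂ) :
    a + t • w ∈ C := by
  by_contra hnot
  obtain ⟨l, u, hlC, hlu⟩ :=
    RCLike.geometric_hahn_banach_closed_point (𝕜 := ℂ) hCconv hCclosed hnot
  have hlw : l w = 0 := hw l u fun c hc => (hlC c hc).le
  have hla := hlC a ha
  rw [map_add, map_smul, hlw, smul_zero, add_zero] at hlu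
  exact lt_asymm hla hlu

/-- The complement of a line-free closed convex set `C ⊆ ℂᵐ` (`m ≥ 2`) satisfies, in
suitable complex affine coordinates at every point `p ∉ C`, the tube condition around a
complex line together with the arbitrarily-large-hyperplane-ball condition: there is an
invertible `ℂ`-affine map `Φ : ℂ^{m-1} × ℂ → ℂᵐ` with `Φ(0,0) = p` such that a tube
`{‖z'‖ < δ}` and, for each `r > 0`, some slice `{(z', v) : ‖z'‖ < r}` are mapped off `C`. -/
theorem complement_line_free_convex_flexC_condition {m : ℕ} (hm : 2 ≤ m)
    (C : Set (EuclideanSpace ℂ (Fin m))) (hCclosed : IsClosed C) (hCconv : Convex ℝ C)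
    (hline : ¬∃ (a v : EuclideanSpace ℂ (Fin m)), v ≠ 0 ∧ ∀ t : ℂ, a + t • v ∈ C)
    (p : EuclideanSpace ℂ (Fin m)) (hp : p ∉ C) :
    ∃ Φ : EuclideanSpace ℂ (Fin (m - 1)) × ℂ → EuclideanSpace ℂ (Fin m),
      (∃ (A : (EuclideanSpace ℂ (Fin (m - 1)) × ℂ) ≃ₗ[ℂ] EuclideanSpace ℂ (Fin m))
          (b : EuclideanSpace ℂ (Fin m)), ∀ z, Φ z = A z + b) ∧
      Φ 0 = p ∧
      (∃ δ > 0, ∀ z : EuclideanSpace ℂ (Fin (m - 1)) × ℂ, ‖z.1‖ < δ → Φ z ∉ C) ∧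
      (∀ r > 0, ∃ v : ℂ, ∀ z' : EuclideanSpace ℂ (Fin (m - 1)), ‖z'‖ < r → Φ (z', v) ∉ C) := by
  obtain ⟨w, hw, f, u, l, M, hfp, hfC, hfw, hlC, hlw⟩ :
      ∃ w : EuclideanSpace ℂ (Fin m), w ≠ 0 ∧
      ∃ (f : EuclideanSpace ℂ (Fin m) →L[ℂ] ℂ) (u : ℝ) (l : EuclideanSpace ℂ (Fin m) →L[ℂ] ℂ)
        (M : ℝ), (f p).re < u ∧ (∀ c ∈ C, u < (f c).re) ∧ f w = 0 ∧
        (∀ c ∈ C, (l c).re ≤ M) ∧ l w ≠ 0 := by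
    obtain ⟨f, u, hfp, hfC⟩ :=
      RCLike.geometric_hahn_banach_point_closed (𝕜 := ℂ) hCconv hCclosed hp
    obtain ⟨w, hwker, hw⟩ := Submodule.exists_mem_ne_zero_of_ne_bot
      (LinearMap.ker_ne_bot_of_finrank_lt (f := (f : EuclideanSpace ℂ (Fin m) →ₗ[ℂ] ℂ))
        (by rw [finrank_euclideanSpace_fin, Module.finrank_self]; omega))
    suffices h : ∃ (l : EuclideanSpace ℂ (Fin m) →L[ℂ] ℂ) (M : ℝ),
        (∀ c ∈ C, (l c).re ≤ M) ∧ l w ≠ 0 by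
      obtain ⟨l, M, hlC, hlw⟩ := h
      exact ⟨w, hw, f, u, l, M, hfp, hfC, hwker, hlC, hlw⟩
    by_contra! hall
    rcases C.eq_empty_or_nonempty with rfl | ⟨a, ha⟩
    · exact hw (inner_self_eq_zero.mp (hall (innerSL ℂ w) 0 (by simp)))
    · exact hline ⟨a, w, hw,
        add_smul_mem_of_forall_bounded_functional_eq_zero hCclosed hCconv ha hall⟩
  obtain ⟨A, hA⟩ := exists_linearEquiv_prod_apply_zero_one hw
  let B : EuclideanSpace ℂ (Fin (m - 1)) →L[ℂ] EuclideanSpace ℂ (Fin m) :=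
    LinearMap.toContinuousLinearMap (A.toLinearMap ∘ₗ LinearMap.inl ℂ _ ℂ)
  have hAB : ∀ (z' : EuclideanSpace ℂ (Fin (m - 1))) (v : ℂ), A (z', v) = B z' + v • w := by
    intro z' v
    have : ((z', v) : EuclideanSpace ℂ (Fin (m - 1)) × ℂ) = (z', 0) + v • (0, 1) := by simp
    rw [this, map_add, map_smul, hA]
    rfl
  refine ⟨fun z => A z + p, ⟨A, p, fun _ => rfl⟩, by simp, ?_, fun r _ => ?_⟩
  · have hcont : Filter.Tendsto (fun z' => (f (B z' + p)).re) (nhds 0) (nhds (f p).re) := by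
      have : Continuous fun z' => (f (B z' + p)).re := by fun_prop
      simpa using this.tendsto 0
    obtain ⟨δ, hδ, hball⟩ := Metric.eventually_nhds_iff.mp (hcont.eventually_lt_const hfp)
    refine ⟨δ, hδ, fun ⟨z', v⟩ hz hmem => ?_⟩
    have h1 := hball (y := z') (by simpa using hz)
    have h2 := hfC _ hmem
    simp only [hAB, map_add, map_smul, hfw, smul_zero, add_zero] at h1 h2
    exact lt_asymm h1 h2
  · refine ⟨((M - (l p).re + ‖l.comp B‖ * r + 1 : ℝ) : ℂ) / l w, fun z' hz hmem => ?_⟩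
    have h1 := hlC _ hmem
    have h2 : -(‖l.comp B‖ * r) ≤ (l (B z')).re :=
      (abs_le.mp ((Complex.abs_re_le_norm _).trans (((l.comp B).le_opNorm z').trans
        (mul_le_mul_of_nonneg_left hz.le (norm_nonneg _))))).1
    simp only [hAB, map_add, map_smul, smul_eq_mul, div_mul_cancel₀ _ hlw, Complex.add_re,
      Complex.ofReal_re] at h1
    linarith
end
end

section
/- Let a₁ ≥ 0, a₂ > 0 and a₃ ∈ ℝ, and let Ω = {x = (x₁, x₂, x₃, x₄) ∈ ℝ⁴ : x₄ > −a₁x₁² − a₂x₂² + a₃x₃²}. Then Ω satisfies condition (FLEX): for every p ∈ Ω there is a 2-dimensional affine subspace Λ ⊆ ℝ⁴ with p ∈ Λ such that (a) there is δ > 0 with {x : dist(x, Λ) < δ} ⊆ Ω, and (b) for every r > 0 there is q ∈ Λ with the closed ball B̄(q, r) ⊆ Ω. -/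
open Metric Set

noncomputable section

/-- Condition (FLEX): every point of `Ω` lies on a 2-dimensional affine subspace `Λ`
such that a `δ`-tube around `Λ` is contained in `Ω`, and `Λ` contains centres of
arbitrarily large closed balls contained in `Ω`. -/
def SatisfiesFlex {n : ℕ} (Ω : Set (EuclideanSpace ℝ (Fin n))) : Prop :=
  ∀ p ∈ Ω, ∃ Λ : AffineSubspace ℝ (EuclideanSpace ℝ (Fin n)),
    Module.finrank ℝ Λ.direction = 2 ∧ p ∈ Λ ∧
    (∃ δ > 0, {x | Metric.infDist x (Λ : Set (EuclideanSpace ℝ (Fin n))) < δ} ⊆ Ω) ∧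
    (∀ r > 0, ∃ q ∈ Λ, Metric.closedBall q r ⊆ Ω)

/-- In a Euclidean space, each coordinate difference is bounded by the distance. -/
theorem abs_sub_apply_le_dist {n : ℕ} (x y : EuclideanSpace ℝ (Fin n)) (i : Fin n) :
    |x i - y i| ≤ dist x y := by
  simpa [dist_eq_norm] using PiLp.norm_apply_le (x - y) i

/-- The plane through `p` spanned by `e₁ + s e₄` and `e₂ + t e₄`. -/
def graphPlane (p : EuclideanSpace ℝ (Fin 4)) (s t : ℝ) :
    AffineSubspace ℝ (EuclideanSpace ℝ (Fin 4)) :=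
  AffineSubspace.mk' p (Submodule.span ℝ {!₂[1, 0, 0, s], !₂[0, 1, 0, t]})

theorem mem_graphPlane_iff {p z : EuclideanSpace ℝ (Fin 4)} {s t : ℝ} :
    z ∈ graphPlane p s t ↔
      z 2 = p 2 ∧ z 3 = p 3 + s * (z 0 - p 0) + t * (z 1 - p 1) := by
  rw [graphPlane, AffineSubspace.mem_mk', Submodule.mem_span_pair]
  constructor
  · rintro ⟨a, b, h⟩
    have h0 := congrArg (· 0) h
    have h1 := congrArg (· 1) h
    have h2 := congrArg (· 2) h
    have h3 := congrArg (· 3) h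
    simp at h0 h1 h2 h3
    rw [← h0, ← h1]
    exact ⟨by linarith, by linarith⟩
  · rintro ⟨h2, h3⟩
    refine ⟨z 0 - p 0, z 1 - p 1, ?_⟩
    ext i
    fin_cases i <;> simp [h2, h3]
    ring

theorem finrank_direction_graphPlane (p : EuclideanSpace ℝ (Fin 4)) (s t : ℝ) :
    Module.finrank ℝ (graphPlane p s t).direction = 2 := by
  have hli : LinearIndependent ℝ
      ![(!₂[1, 0, 0, s] : EuclideanSpace ℝ (Fin 4)), !₂[0, 1, 0, t]] := by
    rw [LinearIndependent.pair_iff]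
    intro a b h
    have h0 := congrArg (· 0) h
    have h1 := congrArg (· 1) h
    simp at h0 h1
    exact ⟨h0, h1⟩
  have := finrank_span_eq_card hli
  rw [Matrix.range_cons_cons_empty, Fintype.card_fin] at this
  rwa [graphPlane, AffineSubspace.direction_mk']

/-- Near the plane tangent to the quadric graph at `p`, the defining function of the supergraph
is bounded below by its value at `p` plus a square, up to an error controlled by the distance
to the plane. -/
theorem quadric_lower_bound {a₁ a₂ a₃ ρ : ℝ} (ha₁ : 0 ≤ a₁)
    {p x z : EuclideanSpace ℝ (Fin 4)}
    (hz : z ∈ graphPlane p (-2 * a₁ * p 0) (-2 * a₂ * p 1)) (hxz : dist x z ≤ ρ) :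
    (p 3 + a₁ * p 0 ^ 2 + a₂ * p 1 ^ 2 - a₃ * p 2 ^ 2) + a₂ * (x 1 - p 1) ^ 2
      - ρ * (1 + |2 * a₁ * p 0| + |2 * a₂ * p 1| + |a₃| * (2 * |p 2| + ρ)) ≤
    x 3 + a₁ * x 0 ^ 2 + a₂ * x 1 ^ 2 - a₃ * x 2 ^ 2 := by
  obtain ⟨hz2, hz3⟩ := mem_graphPlane_iff.1 hz
  have hw (i : Fin 4) : |x i - z i| ≤ ρ := (abs_sub_apply_le_dist x z i).trans hxz
  have hmul (b : ℝ) (i : Fin 4) : -(|b| * ρ) ≤ b * (x i - z i) := by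
    refine (abs_le.1 ?_).1
    rw [abs_mul]
    exact mul_le_mul_of_nonneg_left (hw i) (abs_nonneg b)
  have h0 := hmul (2 * a₁ * p 0) 0
  have h1 := hmul (2 * a₂ * p 1) 1
  have h3 := (abs_le.1 (hw 3)).1
  have h2 : a₃ * ((x 2 - p 2) * (2 * p 2 + (x 2 - p 2))) ≤
      |a₃| * (ρ * (2 * |p 2| + ρ)) := by
    have hw2 := hw 2
    rw [hz2] at hw2
    refine (le_abs_self _).trans ?_
    rw [abs_mul, abs_mul]
    have habs : |2 * p 2 + (x 2 - p 2)| ≤ 2 * |p 2| + ρ := by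
      refine (abs_add_le _ _).trans ?_
      rw [abs_mul, abs_two]
      gcongr
    have hρ : 0 ≤ ρ := (abs_nonneg _).trans hw2
    gcongr
  have hsq : 0 ≤ a₁ * (x 0 - p 0) ^ 2 := by positivity
  nlinarith

/-- The domain `Ω = {x ∈ ℝ⁴ : x₄ > −a₁x₁² − a₂x₂² + a₃x₃²}` (with `a₁ ≥ 0`, `a₂ > 0`,
`a₃ ∈ ℝ`) satisfies condition (FLEX). -/
theorem quadric_supergraph_satisfies_flex (a₁ a₂ a₃ : ℝ) (ha₁ : 0 ≤ a₁) (ha₂ : 0 < a₂) :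
    SatisfiesFlex {x : EuclideanSpace ℝ (Fin 4) |
      -a₁ * (x 0) ^ 2 - a₂ * (x 1) ^ 2 + a₃ * (x 2) ^ 2 < x 3} := by
  intro p hp
  simp only [mem_ofPred_eq] at hp
  set c := p 3 + a₁ * p 0 ^ 2 + a₂ * p 1 ^ 2 - a₃ * p 2 ^ 2 with hc
  have hcpos : 0 < c := by linarith
  refine ⟨graphPlane p (-2 * a₁ * p 0) (-2 * a₂ * p 1), finrank_direction_graphPlane _ _ _,
    mem_graphPlane_iff.2 ⟨rfl, by ring⟩, ?_, ?_⟩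
  · set K := 1 + |2 * a₁ * p 0| + |2 * a₂ * p 1| + |a₃| * (2 * |p 2| + 1) with hK
    have hKpos : 0 < K := by positivity
    have hδ : 0 < c / (c + K) := by positivity
    refine ⟨c / (c + K), hδ, fun x hx => ?_⟩
    obtain ⟨z, hz, hxz⟩ :=
      (infDist_lt_iff ⟨p, mem_graphPlane_iff.2 ⟨rfl, by ring⟩⟩).1 hx
    have hb := quadric_lower_bound (a₃ := a₃) ha₁ hz hxz.le
    have hδ1 : c / (c + K) ≤ 1 := by rw [div_le_one (by positivity)]; linarith
    have hδK : c / (c + K) * K < c := by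
      rw [div_mul_eq_mul_div, div_lt_iff₀ (by positivity)]
      nlinarith
    have hle : c / (c + K) * (1 + |2 * a₁ * p 0| + |2 * a₂ * p 1|
        + |a₃| * (2 * |p 2| + c / (c + K))) ≤ c / (c + K) * K := by
      rw [hK] at hδ hδ1 ⊢
      gcongr
    have hsq : 0 ≤ a₂ * (x 1 - p 1) ^ 2 := by positivity
    simp only [mem_ofPred_eq]
    linarith
  · intro r hr
    set M := r * (1 + |2 * a₁ * p 0| + |2 * a₂ * p 1| + |a₃| * (2 * |p 2| + r)) with hM
    have hMpos : 0 < M := by positivity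
    set T := r + (1 + M / a₂) with hT
    have hq : !₂[p 0, p 1 + T, p 2, p 3 + -2 * a₂ * p 1 * T] ∈
        graphPlane p (-2 * a₁ * p 0) (-2 * a₂ * p 1) :=
      mem_graphPlane_iff.2 ⟨by simp, by simp⟩
    refine ⟨_, hq, fun x hx => ?_⟩
    have hb := quadric_lower_bound (a₃ := a₃) ha₁ hq (mem_closedBall.1 hx)
    have h1 := (abs_le.1 ((abs_sub_apply_le_dist x _ 1).trans (mem_closedBall.1 hx))).1
    simp at h1
    have hMa : 0 < M / a₂ := by positivity
    have hsq : M / a₂ ≤ (x 1 - p 1) ^ 2 := by nlinarith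
    have hM_le : M ≤ a₂ * (x 1 - p 1) ^ 2 := by rwa [div_le_iff₀' ha₂] at hsq
    simp only [mem_ofPred_eq]
    linarith
end
end

section
/- Let n ≥ 4, let a₂ > 0 and a₃ ∈ ℝ, and let W = {x = (x₁, …, xₙ) ∈ ℝⁿ : x₄ > −a₂|x₂| + a₃|x₃|}. Then W satisfies condition (FLEX): for every p ∈ W there is a 2-dimensional affine subspace Λ ⊆ ℝⁿ with p ∈ Λ such that (a) there is δ > 0 with {x : dist(x, Λ) < δ} ⊆ W, and (b) for every r > 0 there is q ∈ Λ with the closed ball B̄(q, r) ⊆ W. -/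
open Metric Set

noncomputable section

/-- The function `x ↦ x_k + a|x_i| - b|x_j|` decreases by at most `(1 + |a| + |b|) * dist x y`. -/
lemma wedgeFunction_sub_le {n : ℕ} (i j k : Fin n) (a b : ℝ) (x y : EuclideanSpace ℝ (Fin n)) :
    (y k + a * |y i| - b * |y j|) - (1 + |a| + |b|) * dist x y ≤
      x k + a * |x i| - b * |x j| := by
  have hcoord (l : Fin n) : |x l - y l| ≤ dist x y := by
    simpa [dist_eq_norm] using PiLp.norm_apply_le (x - y) l
  have hmul (c : ℝ) (l : Fin n) : abs (c * |x l| - c * |y l|) ≤ |c| * dist x y := by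
    rw [← mul_sub, abs_mul]
    exact mul_le_mul_of_nonneg_left ((abs_abs_sub_abs_le _ _).trans (hcoord l)) (abs_nonneg c)
  have hk := abs_le.mp (hcoord k)
  have hi := abs_le.mp (hmul a i)
  have hj := abs_le.mp (hmul b j)
  linarith [hk.1, hi.1, hj.2]

/-- The wedge `W = {x ∈ ℝⁿ : x₄ > −a₂|x₂| + a₃|x₃|}` (with `n ≥ 4`, `a₂ > 0`, `a₃ ∈ ℝ`)
satisfies condition (FLEX). -/
theorem wedge_satisfies_flex {n : ℕ} (hn : 4 ≤ n) (a₂ a₃ : ℝ) (ha₂ : 0 < a₂) :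
    SatisfiesFlex {x : EuclideanSpace ℝ (Fin n) |
      -a₂ * |x ⟨1, by omega⟩| + a₃ * |x ⟨2, by omega⟩| < x ⟨3, by omega⟩} := by
  intro p hp
  obtain ⟨s, hs, hsp⟩ : ∃ s : ℝ, |s| = 1 ∧ s * p ⟨1, by omega⟩ = |p ⟨1, by omega⟩| := by
    rcases le_total 0 (p ⟨1, by omega⟩) with h | h
    · exact ⟨1, by simp, by simp [abs_of_nonneg h]⟩
    · exact ⟨-1, by simp, by simp [abs_of_nonpos h]⟩
  set i₀ : Fin n := ⟨0, by omega⟩ with hi₀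
  set i₁ : Fin n := ⟨1, by omega⟩ with hi₁
  set i₂ : Fin n := ⟨2, by omega⟩ with hi₂
  set i₃ : Fin n := ⟨3, by omega⟩ with hi₃
  have hp : -a₂ * |p i₁| + a₃ * |p i₂| < p i₃ := hp
  have hss : s * s = 1 := by rw [← abs_mul_abs_self, hs, one_mul]
  let u : EuclideanSpace ℝ (Fin n) := EuclideanSpace.single i₀ 1
  let v : EuclideanSpace ℝ (Fin n) := EuclideanSpace.single i₁ s - EuclideanSpace.single i₃ a₂
  have hu₀ : u i₀ = 1 := by simp [u]
  have hu₁ : u i₁ = 0 := by simp [u, hi₀, hi₁]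
  have hu₂ : u i₂ = 0 := by simp [u, hi₀, hi₂]
  have hu₃ : u i₃ = 0 := by simp [u, hi₀, hi₃]
  have hv₀ : v i₀ = 0 := by simp [v, hi₀, hi₁, hi₃]
  have hv₁ : v i₁ = s := by simp [v, hi₁, hi₃]
  have hv₂ : v i₂ = 0 := by simp [v, hi₁, hi₂, hi₃]
  have hv₃ : v i₃ = -a₂ := by simp [v, hi₁, hi₃]
  have hli : LinearIndependent ℝ ![u, v] := by
    refine LinearIndependent.pair_iff.mpr fun α t h => ?_
    have h₀ := congrArg (fun x : EuclideanSpace ℝ (Fin n) => x i₀) h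
    have h₃ := congrArg (fun x : EuclideanSpace ℝ (Fin n) => x i₃) h
    simp [hu₀, hv₀, hu₃, hv₃] at h₀ h₃
    exact ⟨h₀, h₃.resolve_right ha₂.ne'⟩
  let Λ := AffineSubspace.mk' p (Submodule.span ℝ {u, v})
  have hΛ : ∀ y ∈ Λ, p i₃ + a₂ * |p i₁| - a₃ * |p i₂| ≤ y i₃ + a₂ * |y i₁| - a₃ * |y i₂| := by
    intro y hy
    obtain ⟨α, t, h⟩ := Submodule.mem_span_pair.mp (AffineSubspace.mem_mk'.mp hy)
    obtain rfl : y = α • u + t • v + p := by rw [h]; simp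
    have habs : |p i₁| + t ≤ |t * s + p i₁| := by
      calc |p i₁| + t = s * (t * s + p i₁) := by rw [← hsp]; linear_combination -t * hss
        _ ≤ |s * (t * s + p i₁)| := le_abs_self _
        _ = |t * s + p i₁| := by rw [abs_mul, hs, one_mul]
    simp only [PiLp.add_apply, PiLp.smul_apply, smul_eq_mul, hu₁, hu₂, hu₃, hv₁, hv₂, hv₃,
      mul_zero, zero_add]
    nlinarith [mul_le_mul_of_nonneg_left habs ha₂.le]
  have hL : 0 < 1 + |a₂| + |a₃| := by positivity
  refine ⟨Λ, ?_, AffineSubspace.self_mem_mk' _ _, ?_, ?_⟩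
  · rw [AffineSubspace.direction_mk']
    rw [← Matrix.range_cons_cons_empty u v ![], finrank_span_eq_card hli, Fintype.card_fin]
  · refine ⟨(p i₃ + a₂ * |p i₁| - a₃ * |p i₂|) / (1 + |a₂| + |a₃|),
      div_pos (by linarith) hL, fun x hx => ?_⟩
    obtain ⟨y, hy, hxy⟩ := (Metric.infDist_lt_iff ⟨p, AffineSubspace.self_mem_mk' _ _⟩).mp hx
    rw [lt_div_iff₀' hL] at hxy
    have hsub := wedgeFunction_sub_le i₁ i₂ i₃ a₂ a₃ x y
    have hmin := hΛ y hy
    change -a₂ * |x i₁| + a₃ * |x i₂| < x i₃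
    linarith
  · intro r _
    let T := (1 + (1 + |a₂| + |a₃|) * r + a₃ * |p i₂| - p i₃) / a₂
    have hT : a₂ * T = 1 + (1 + |a₂| + |a₃|) * r + a₃ * |p i₂| - p i₃ := by
      simp only [T]; field_simp
    refine ⟨-T • v + p, ?_, fun x hx => ?_⟩
    · refine AffineSubspace.mem_mk'.mpr (Submodule.mem_span_pair.mpr ⟨0, -T, ?_⟩)
      simp
    have hsub := wedgeFunction_sub_le i₁ i₂ i₃ a₂ a₃ x (-T • v + p)
    have hr := mul_le_mul_of_nonneg_left (Metric.mem_closedBall.mp hx) hL.le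
    have hnonneg := mul_nonneg ha₂.le (abs_nonneg ((-T • v + p) i₁))
    have h₂ : (-T • v + p) i₂ = p i₂ := by simp [hv₂]
    have h₃ : (-T • v + p) i₃ = a₂ * T + p i₃ := by simp [hv₃, mul_comm]
    rw [h₂, h₃] at hsub
    change -a₂ * |x i₁| + a₃ * |x i₂| < x i₃
    linarith
end
end

section
/- Let L ⊆ ℝⁿ be a closed set and x ∈ L. For i = 1, 2 let Uᵢ ⊆ ℝⁿ be an open neighbourhood of x and τᵢ : Uᵢ → ℝ a smooth function with Dτᵢ(x) ≠ 0 and L ∩ Uᵢ = {y ∈ Uᵢ : τᵢ(y) ≤ 0}. Let f : 𝔻 → ℝⁿ be a smooth map with f(0) = x, and suppose there are c > 0, k ∈ ℕ and ρ ∈ (0,1) such that f(z) ∈ U₁ and τ₁(f(z)) ≥ c|z|^{k} for all |z| ≤ ρ. Then there are c' > 0 and ρ' ∈ (0,1) such that f(z) ∈ U₂ and τ₂(f(z)) ≥ c'|z|^{k} for all |z| ≤ ρ'. (The notion of touching a smoothly bounded set to finite order at a boundary point does not depend on the choice of the local defining function.) -/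
open Metric Set

noncomputable section

open Filter Topology in
/-- First-order expansion of a strictly differentiable function along a direction, uniform in the
base point. -/
theorem HasStrictFDerivAt.eventually_abs_sub_smul_le {E : Type*} [NormedAddCommGroup E]
    [NormedSpace ℝ E] {τ : E → ℝ} {τ' : E →L[ℝ] ℝ} {x : E} (h : HasStrictFDerivAt τ τ' x) (v : E)
    {ε : ℝ} (hε : 0 < ε) :
    ∀ᶠ p : E × ℝ in 𝓝 (x, 0), |τ p.1 - τ (p.1 - p.2 • v) - p.2 * τ' v| ≤ |p.2| * ε := by
  have hδ : 0 < ε / (‖v‖ + 1) := by positivity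
  have hcont : Tendsto (fun p : E × ℝ => (p.1, p.1 - p.2 • v)) (𝓝 (x, 0)) (𝓝 (x, x)) := by
    have : Continuous (fun p : E × ℝ => (p.1, p.1 - p.2 • v)) := by fun_prop
    simpa using this.tendsto (x, 0)
  filter_upwards [hcont.eventually (h.isLittleO.def hδ)] with p hp
  simp only [sub_sub_cancel, map_smul, smul_eq_mul, Real.norm_eq_abs, norm_smul] at hp
  refine hp.trans ?_
  have hv : ε / (‖v‖ + 1) * ‖v‖ ≤ ε := by
    rw [div_mul_eq_mul_div, div_le_iff₀ (by positivity)]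
    nlinarith [norm_nonneg v]
  nlinarith [abs_nonneg p.2]

open Filter Topology in
/-- A function with positive derivative in direction `v` strictly increases in that direction. -/
theorem HasStrictFDerivAt.eventually_lt_add_smul {E : Type*} [NormedAddCommGroup E]
    [NormedSpace ℝ E] {τ : E → ℝ} {τ' : E →L[ℝ] ℝ} {x v : E} (h : HasStrictFDerivAt τ τ' x)
    (hv : 0 < τ' v) : ∀ᶠ t : ℝ in 𝓝[>] 0, τ x < τ (x + t • v) := by
  have hcont : Tendsto (fun t : ℝ => (x, -t)) (𝓝[>] 0) (𝓝 (x, 0)) := by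
    have : Continuous (fun t : ℝ => (x, -t)) := by fun_prop
    simpa using (this.tendsto 0).mono_left nhdsWithin_le_nhds
  filter_upwards [hcont.eventually (h.eventually_abs_sub_smul_le v (half_pos hv)),
    self_mem_nhdsWithin] with t ht htpos
  have htpos : 0 < t := htpos
  simp only [neg_smul, sub_neg_eq_add, abs_neg, _root_.abs_of_pos htpos] at ht
  nlinarith [(abs_le.mp ht).2, mul_pos htpos hv]

theorem ContinuousLinearMap.exists_apply_pos {E : Type*} [NormedAddCommGroup E]
    [NormedSpace ℝ E] {φ : E →L[ℝ] ℝ} (hφ : φ ≠ 0) : ∃ v, 0 < φ v := by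
  obtain ⟨v, hv⟩ := DFunLike.ne_iff.mp hφ
  rcases lt_or_gt_of_ne hv with h | h
  · exact ⟨-v, by simpa using h⟩
  · exact ⟨v, by simpa using h⟩

open Filter Topology in
/-- Two functions with nonzero strict derivatives at a common zero and the same positivity set near
it are comparable on that set. -/
theorem exists_mul_le_of_eventually_pos_iff {E : Type*} [NormedAddCommGroup E]
    [NormedSpace ℝ E] {τ₁ τ₂ : E → ℝ} {τ₁' τ₂' : E →L[ℝ] ℝ} {x : E}
    (h₁ : HasStrictFDerivAt τ₁ τ₁' x) (h₂ : HasStrictFDerivAt τ₂ τ₂' x)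
    (hne₁ : τ₁' ≠ 0) (hne₂ : τ₂' ≠ 0) (hx : τ₁ x = 0)
    (hiff : ∀ᶠ y in 𝓝 x, (0 < τ₁ y ↔ 0 < τ₂ y)) :
    0 ≤ τ₂ x ∧ ∃ C > 0, ∀ᶠ y in 𝓝 x, 0 < τ₁ y → C * τ₁ y ≤ τ₂ y := by
  have hx₂ : τ₂ x ≤ 0 := by
    have := hiff.self_of_nhds
    rw [hx] at this
    exact not_lt.mp fun h => lt_irrefl _ (this.mpr h)
  have hline (v : E) : Tendsto (fun t : ℝ => x + t • v) (𝓝[>] 0) (𝓝 x) := by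
    have : Continuous (fun t : ℝ => x + t • v) := by fun_prop
    simpa using (this.tendsto 0).mono_left nhdsWithin_le_nhds
  obtain ⟨v₁, hv₁⟩ := ContinuousLinearMap.exists_apply_pos hne₁
  obtain ⟨w, hw⟩ := ContinuousLinearMap.exists_apply_pos hne₂
  have hsign : 0 ≤ τ₂' v₁ := by
    by_contra! hneg
    have hneg' : 0 < (-τ₂') v₁ := by simpa using hneg
    obtain ⟨t, ht₁, ht₂, ht⟩ := ((h₁.eventually_lt_add_smul hv₁).and
      ((h₂.neg.eventually_lt_add_smul hneg').and ((hline v₁).eventually hiff))).exists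
    have := ht.mp (hx ▸ ht₁)
    simp only [Pi.neg_apply] at ht₂
    linarith
  obtain ⟨v, hp₁, hp₂⟩ : ∃ v, 0 < τ₁' v ∧ 0 < τ₂' v := by
    have hδ : 0 < τ₁' v₁ / (2 * (|τ₁' w| + 1)) := by positivity
    refine ⟨v₁ + (τ₁' v₁ / (2 * (|τ₁' w| + 1))) • w, ?_, ?_⟩
    · have hb : τ₁' v₁ / (2 * (|τ₁' w| + 1)) * (2 * (|τ₁' w| + 1)) = τ₁' v₁ :=
        div_mul_cancel₀ _ (by positivity)
      simp only [map_add, map_smul, smul_eq_mul]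
      nlinarith [neg_abs_le (τ₁' w), abs_nonneg (τ₁' w)]
    · simp only [map_add, map_smul, smul_eq_mul]
      positivity
  refine ⟨?_, τ₂' v / (6 * τ₁' v), by positivity, ?_⟩
  · by_contra! hneg
    obtain ⟨t, ht₁, ht₂, ht⟩ := ((h₁.eventually_lt_add_smul hp₁).and
      (((hline v).eventually (h₂.continuousAt.eventually_lt_const hneg)).and
        ((hline v).eventually hiff))).exists
    exact lt_asymm ht₂ (ht.mp (hx ▸ ht₁))
  have hstep : Tendsto (fun y => (y, τ₁ y / (3 * τ₁' v))) (𝓝 x) (𝓝 (x, 0)) := by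
    have := h₁.continuousAt.tendsto.div_const (3 * τ₁' v)
    rw [hx, zero_div] at this
    exact tendsto_id.prodMk_nhds this
  have hback : Tendsto (fun y => y - (τ₁ y / (3 * τ₁' v)) • v) (𝓝 x) (𝓝 x) := by
    have : Continuous (fun p : E × ℝ => p.1 - p.2 • v) := by fun_prop
    simpa [Function.comp_def] using (this.tendsto (x, 0)).comp hstep
  filter_upwards [hstep.eventually (h₁.eventually_abs_sub_smul_le v (half_pos hp₁)),
    hstep.eventually (h₂.eventually_abs_sub_smul_le v (half_pos hp₂)),
    hback.eventually hiff] with y hy₁ hy₂ hy hpos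
  have htpos : 0 < τ₁ y / (3 * τ₁' v) := by positivity
  have htmul : τ₁ y / (3 * τ₁' v) * τ₁' v = τ₁ y / 3 := by field_simp
  have hC : τ₂' v / (6 * τ₁' v) * τ₁ y = τ₁ y / (3 * τ₁' v) * (τ₂' v / 2) := by
    field_simp
    norm_num
  simp only [abs_of_pos htpos] at hy₁ hy₂
  have h₁' := (abs_le.mp hy₁).2
  have h₂' := (abs_le.mp hy₂).1
  have := hy.mp (by linarith)
  rw [hC]
  linarith

/-- Touching a smoothly bounded closed set to finite order at a boundary point does not
depend on the choice of the local defining function: if `τ₁`, `τ₂` are two local defining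
functions for `L` at `x` and a smooth map `f : 𝔻 → ℝⁿ` with `f(0) = x` satisfies
`τ₁(f(z)) ≥ c|z|^k` near `0`, then `τ₂(f(z)) ≥ c'|z|^k` near `0` for some `c' > 0`. -/
theorem touching_independent_of_defining_function {n : ℕ}
    (L : Set (EuclideanSpace ℝ (Fin n))) (hLclosed : IsClosed L)
    (x : EuclideanSpace ℝ (Fin n)) (hx : x ∈ L)
    (U₁ U₂ : Set (EuclideanSpace ℝ (Fin n))) (hU₁ : IsOpen U₁) (hU₂ : IsOpen U₂)
    (hxU₁ : x ∈ U₁) (hxU₂ : x ∈ U₂)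
    (τ₁ τ₂ : EuclideanSpace ℝ (Fin n) → ℝ)
    (hτ₁ : ContDiffOn ℝ (⊤ : ℕ∞) τ₁ U₁) (hτ₂ : ContDiffOn ℝ (⊤ : ℕ∞) τ₂ U₂)
    (hd₁ : fderiv ℝ τ₁ x ≠ 0) (hd₂ : fderiv ℝ τ₂ x ≠ 0)
    (hLU₁ : L ∩ U₁ = {y ∈ U₁ | τ₁ y ≤ 0}) (hLU₂ : L ∩ U₂ = {y ∈ U₂ | τ₂ y ≤ 0})
    (f : ℂ → EuclideanSpace ℝ (Fin n)) (hf : ContDiffOn ℝ (⊤ : ℕ∞) f (ball (0 : ℂ) 1))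
    (hf0 : f 0 = x)
    (c : ℝ) (hc : 0 < c) (k : ℕ) (ρ : ℝ) (hρ0 : 0 < ρ) (hρ1 : ρ < 1)
    (htouch : ∀ z : ℂ, ‖z‖ ≤ ρ → f z ∈ U₁ ∧ c * ‖z‖ ^ k ≤ τ₁ (f z)) :
    ∃ (c' ρ' : ℝ), 0 < c' ∧ 0 < ρ' ∧ ρ' < 1 ∧
      ∀ z : ℂ, ‖z‖ ≤ ρ' → f z ∈ U₂ ∧ c' * ‖z‖ ^ k ≤ τ₂ (f z) := by
  have hpos : ∀ {U : Set (EuclideanSpace ℝ (Fin n))} {τ : EuclideanSpace ℝ (Fin n) → ℝ},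
      L ∩ U = {y ∈ U | τ y ≤ 0} → ∀ y ∈ U, (y ∈ L ↔ τ y ≤ 0) := fun h y hy => by
    simpa [hy] using Set.ext_iff.mp h y
  have hs₁ := (hτ₁.contDiffAt (hU₁.mem_nhds hxU₁)).hasStrictFDerivAt (by simp)
  have hs₂ := (hτ₂.contDiffAt (hU₂.mem_nhds hxU₂)).hasStrictFDerivAt (by simp)
  have hxle : τ₁ x ≤ 0 := (hpos hLU₁ x hxU₁).mp hx
  have h0 : c * ‖(0 : ℂ)‖ ^ k ≤ τ₁ x := hf0 ▸ (htouch 0 (by simpa using hρ0.le)).2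
  have hx₁ : τ₁ x = 0 := hxle.antisymm (le_trans (by positivity) h0)
  have hiff : ∀ᶠ y in nhds x, (0 < τ₁ y ↔ 0 < τ₂ y) := by
    filter_upwards [hU₁.mem_nhds hxU₁, hU₂.mem_nhds hxU₂] with y hy₁ hy₂
    rw [← not_le, ← not_le, ← hpos hLU₁ y hy₁, ← hpos hLU₂ y hy₂]
  obtain ⟨hx₂, C, hC, hcomp⟩ := exists_mul_le_of_eventually_pos_iff hs₁ hs₂ hd₁ hd₂ hx₁ hiff
  have hfc : Filter.Tendsto f (nhds 0) (nhds x) := by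
    have := (hf.continuousOn.continuousAt (ball_mem_nhds (0 : ℂ) one_pos)).tendsto
    rwa [hf0] at this
  obtain ⟨r, hr, hball⟩ := Metric.eventually_nhds_iff.mp
    (hfc.eventually (hcomp.and (hU₂.mem_nhds hxU₂)))
  refine ⟨C * c, min ρ (r / 2), by positivity, by positivity,
    (min_le_left _ _).trans_lt hρ1, fun z hz => ?_⟩
  have hzr : ‖z‖ ≤ r / 2 := hz.trans (min_le_right _ _)
  obtain ⟨hle, hmem⟩ := hball (y := z) (by rw [dist_zero_right]; linarith)
  refine ⟨hmem, ?_⟩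
  have ht := (htouch z (hz.trans (min_le_left _ _))).2
  rcases eq_or_ne z 0 with rfl | hz0
  · rw [hf0, mul_assoc]
    rw [hx₁] at h0
    exact (mul_nonpos_of_nonneg_of_nonpos hC.le h0).trans hx₂
  · have hzpos : 0 < ‖z‖ := norm_pos_iff.mpr hz0
    calc C * c * ‖z‖ ^ k = C * (c * ‖z‖ ^ k) := mul_assoc _ _ _
      _ ≤ C * τ₁ (f z) := by gcongr
      _ ≤ τ₂ (f z) := hle (lt_of_lt_of_le (by positivity) ht)
end
end
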